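/- Let R be a commutative Noetherian local ring and A a ring with R[X] ⊆ A ⊆ R[X, X⁻¹]. Let P, Q be finitely generated projective A-modules of constant rank with P_f ≅ Q_f for some special monic polynomial f ∈ R[X]. If P (or Q) has a direct summand of rank one, then P ≅ Q. -/

import Mathlib

set_option synthInstance.maxHeartbeats 1000000
set_option maxHeartbeats 1000000

open Polynomial

/-- A polynomial is special monic if it is monic and has constant term `1`. -/
def IsSpecialMonic {R : Type*} [CommRing R] (f : R[X]) : Prop :=
  f.Monic ∧ f.coeff 0 = 1

/-- A module has constant rank `n` if its localization at every prime has rank `n`. -/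
def HasConstRank (A : Type*) [CommRing A] (M : Type*) [AddCommGroup M] [Module A M]
    (n : ℕ) : Prop :=
  ∀ (𝔭 : Ideal A) [𝔭.IsPrime],
    Module.finrank (Localization.AtPrime 𝔭) (LocalizedModule 𝔭.primeCompl M) = n

/-- A module `P` has a rank-one direct summand if there is a finitely generated projective
module `L` of constant rank one together with a split monomorphism `L → P`. -/
def HasRankOneSummand (A : Type) [CommRing A] (P : Type) [AddCommGroup P]
    [Module A P] : Prop :=
  ∃ (L : Type) (_ : AddCommGroup L) (_ : Module A L),
    Module.Finite A L ∧ Module.Projective A L ∧ HasConstRank A L 1 ∧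
    ∃ (ι : L →ₗ[A] P) (ρ : P →ₗ[A] L), ρ ∘ₗ ι = LinearMap.id

section Special

variable {R A : Type*} [CommRing R] [CommRing A] [Algebra R A]

lemma IsSpecialMonic.isCoprime_X_pow {f : R[X]} (hf : IsSpecialMonic f) (n : ℕ) :
    IsCoprime (X ^ n) f := by
  refine IsCoprime.pow_left ⟨-f.divX, 1, ?_⟩
  have h := f.divX_mul_X_add
  rw [hf.2, C_1] at h
  linear_combination -h

lemma IsSpecialMonic.pow {f : R[X]} (hf : IsSpecialMonic f) (n : ℕ) : IsSpecialMonic (f ^ n) :=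
  ⟨hf.1.pow n, by rw [coeff_zero_eq_eval_zero, eval_pow, ← coeff_zero_eq_eval_zero, hf.2, one_pow]⟩

lemma IsSpecialMonic.exists_mul_pow_add_mul {f : R[X]} (hf : IsSpecialMonic f) (x : A) (n : ℕ) :
    ∃ g h : R[X], aeval x g * x ^ n + aeval x h * aeval x f = 1 := by
  obtain ⟨g, h, hgh⟩ := hf.isCoprime_X_pow n
  exact ⟨g, h, by simpa using congr_arg (aeval x) hgh⟩

/-- `x` makes `A` a subring of the Laurent polynomials containing the polynomials. -/
structure IsLaurentVariable (R : Type*) {A : Type*} [CommRing R] [CommRing A] [Algebra R A]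
    (x : A) : Prop where
  aeval_injective : Function.Injective (aeval (R := R) x)
  mul_left_injective : ∀ a : A, x * a = 0 → a = 0
  exists_pow_mul : ∀ a : A, ∃ (n : ℕ) (q : R[X]), x ^ n * a = aeval x q

namespace IsLaurentVariable

variable {x : A} (hx : IsLaurentVariable R x) {f : R[X]} (hf : IsSpecialMonic f)

include hx

lemma eq_zero_of_pow_mul_eq_zero (n : ℕ) {a : A} (ha : x ^ n * a = 0) : a = 0 := by
  induction n with
  | zero => simpa using ha
  | succ n ih =>
    rw [pow_succ', mul_assoc] at ha
    exact ih (hx.mul_left_injective _ ha)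

include hf

lemma isRegular_aeval : IsRegular (aeval x f) := by
  rw [← isLeftRegular_iff_isRegular, isLeftRegular_iff_right_eq_zero_of_mul]
  intro a ha
  obtain ⟨n, q, hq⟩ := hx.exists_pow_mul a
  have h : f * q = 0 := hx.aeval_injective (by
    rw [map_mul, ← hq, map_zero]
    linear_combination x ^ n * ha)
  rw [hf.1.mul_right_eq_zero_iff] at h
  exact hx.eq_zero_of_pow_mul_eq_zero n (by rw [hq, h, map_zero])

/-- Modulo a special monic polynomial `A` agrees with the polynomial ring. -/
lemma nonempty_quotient_algEquiv :
    Nonempty ((R[X] ⧸ Ideal.span {f}) ≃ₐ[R] (A ⧸ Ideal.span {aeval x f})) := by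
  let g : R[X] →ₐ[R] A ⧸ Ideal.span {aeval x f} :=
    (Ideal.Quotient.mkₐ R (Ideal.span {aeval x f})).comp (aeval x)
  have hg : Function.Surjective g := by
    intro z
    obtain ⟨a, rfl⟩ := Ideal.Quotient.mk_surjective z
    obtain ⟨n, q, hq⟩ := hx.exists_pow_mul a
    obtain ⟨c, d, hcd⟩ := hf.exists_mul_pow_add_mul x n
    refine ⟨c * q, Ideal.Quotient.eq.mpr (Ideal.mem_span_singleton'.mpr ⟨-(aeval x d * a), ?_⟩)⟩
    simp only [RingHom.coe_coe, map_mul]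
    linear_combination (-a) * hcd + aeval x c * hq
  have hker : RingHom.ker g = Ideal.span {f} := by
    ext q
    rw [RingHom.mem_ker, Ideal.mem_span_singleton]
    change Ideal.Quotient.mk _ (aeval x q) = 0 ↔ _
    rw [Ideal.Quotient.eq_zero_iff_mem, Ideal.mem_span_singleton']
    constructor
    · rintro ⟨a, ha⟩
      obtain ⟨n, q', hq'⟩ := hx.exists_pow_mul a
      have h : f * q' = X ^ n * q := hx.aeval_injective (by
        simp only [map_mul, map_pow, aeval_X, ← hq', ← ha]
        ring)
      exact (hf.isCoprime_X_pow n).symm.dvd_of_dvd_mul_left (h ▸ dvd_mul_right _ _)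
    · rintro ⟨q', rfl⟩
      exact ⟨aeval x q', by rw [map_mul, mul_comm]⟩
  exact ⟨(Ideal.quotientEquivAlgOfEq R hker.symm).trans
    (Ideal.quotientKerAlgEquivOfSurjective hg)⟩

lemma free_quotient : Module.Free R (A ⧸ Ideal.span {aeval x f}) := by
  obtain ⟨e⟩ := hx.nonempty_quotient_algEquiv hf
  have := hf.1.free_quotient
  exact Module.Free.of_equiv e.toLinearEquiv

lemma finite_quotient : Module.Finite R (A ⧸ Ideal.span {aeval x f}) := by
  obtain ⟨e⟩ := hx.nonempty_quotient_algEquiv hf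
  have := hf.1.finite_quotient
  exact Module.Finite.equiv e.toLinearEquiv

end IsLaurentVariable

end Special

open TensorProduct

section Pencil

variable {R A : Type*} [CommRing R] [CommRing A] [Algebra R A]
  {M : Type*} [AddCommGroup M] [Module R M]

/-- The linear pencil `x - T` on `A ⊗ M`. -/
noncomputable def pencil (x : A) (T : M →ₗ[R] M) : A ⊗[R] M →ₗ[A] A ⊗[R] M :=
  x • LinearMap.id - T.baseChange A

lemma pencil_apply (x : A) (T : M →ₗ[R] M) (y : A ⊗[R] M) :
    pencil x T y = x • y - T.baseChange A y := rfl

lemma baseChange_pow_apply_succ (T : M →ₗ[R] M) (n : ℕ) (y : A ⊗[R] M) :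
    (T ^ (n + 1)).baseChange A y = T.baseChange A ((T ^ n).baseChange A y) := by
  rw [pow_succ', Module.End.mul_eq_comp, LinearMap.baseChange_comp, LinearMap.comp_apply]

lemma pow_smul_sub_mem_range_pencil (x : A) (T : M →ₗ[R] M) (n : ℕ) (y : A ⊗[R] M) :
    x ^ n • y - (T ^ n).baseChange A y ∈ LinearMap.range (pencil x T) := by
  induction n with
  | zero => simp [Module.End.one_eq_id, LinearMap.baseChange_id]
  | succ n ih =>
    have h : x ^ (n + 1) • y - (T ^ (n + 1)).baseChange A y =
        x • (x ^ n • y - (T ^ n).baseChange A y) + pencil x T ((T ^ n).baseChange A y) := by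
      rw [pencil_apply, baseChange_pow_apply_succ, smul_sub, smul_smul, pow_succ']
      abel
    rw [h]
    exact add_mem (Submodule.smul_mem _ _ ih) ⟨_, rfl⟩

lemma aeval_smul_sub_mem_range_pencil (x : A) (T : M →ₗ[R] M) (q : R[X]) (m : M) :
    aeval x q • ((1 : A) ⊗ₜ[R] m) - (1 : A) ⊗ₜ[R] (aeval T q m) ∈
      LinearMap.range (pencil x T) := by
  induction q using Polynomial.induction_on' with
  | add p q hp hq =>
    have h := add_mem hp hq
    rw [map_add, map_add, add_smul, LinearMap.add_apply, TensorProduct.tmul_add]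
    convert h using 1
    abel
  | monomial n r =>
    have h := pow_smul_sub_mem_range_pencil x T n ((1 : A) ⊗ₜ[R] m)
    have h2 := Submodule.smul_mem _ (algebraMap R A r) h
    simp only [aeval_monomial]
    convert h2 using 1
    rw [smul_sub, smul_smul]
    simp [Module.algebraMap_end_apply, LinearMap.baseChange_tmul, TensorProduct.smul_tmul']

/-- If every element of `A` becomes a polynomial in `x` after multiplication by a power of `x`
and `T` is surjective, then `A ⊗ M` is generated by constants modulo the pencil `x - T`. -/
lemma exists_sub_mem_range_pencil (x : A)
    (hx : ∀ a : A, ∃ (n : ℕ) (q : R[X]), x ^ n * a = aeval x q)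
    (T : M →ₗ[R] M) (hT : Function.Surjective T) (y : A ⊗[R] M) :
    ∃ m : M, y - (1 : A) ⊗ₜ[R] m ∈ LinearMap.range (pencil x T) := by
  induction y with
  | zero => exact ⟨0, by simp⟩
  | add y z hy hz =>
    obtain ⟨m, hm⟩ := hy
    obtain ⟨n, hn⟩ := hz
    refine ⟨m + n, ?_⟩
    convert add_mem hm hn using 1
    rw [TensorProduct.tmul_add]
    abel
  | tmul a m =>
    obtain ⟨n, q, hq⟩ := hx a
    obtain ⟨m, rfl⟩ : ∃ m', (T ^ n) m' = m := by
      rw [Module.End.coe_pow]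
      exact hT.iterate n m
    refine ⟨aeval T q m, ?_⟩
    have h1 := pow_smul_sub_mem_range_pencil x T n (a ⊗ₜ[R] m)
    have h2 := aeval_smul_sub_mem_range_pencil x T q m
    convert sub_mem h2 h1 using 1
    rw [LinearMap.baseChange_tmul, TensorProduct.smul_tmul', TensorProduct.smul_tmul',
      smul_eq_mul, smul_eq_mul, hq, mul_one]
    abel

lemma aeval_smul_eq_of_pencil_eq_zero (x : A) (T : M →ₗ[R] M) (q : R[X]) {y : A ⊗[R] M}
    (hy : pencil x T y = 0) : aeval x q • y = (aeval T q).baseChange A y := by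
  have hpow (n : ℕ) : x ^ n • y = (T ^ n).baseChange A y := by
    induction n with
    | zero => simp [Module.End.one_eq_id, LinearMap.baseChange_id]
    | succ n ih =>
      rw [baseChange_pow_apply_succ, ← ih, map_smul, ← sub_eq_zero.mp hy, pow_succ, mul_smul]
      rfl
  induction q using Polynomial.induction_on' with
  | add p q hp hq =>
    rw [map_add, map_add, add_smul, LinearMap.baseChange_add, LinearMap.add_apply, hp, hq]
  | monomial n r =>
    rw [aeval_monomial, aeval_monomial, mul_smul, hpow, ← Algebra.smul_def,
      LinearMap.baseChange_smul, LinearMap.smul_apply, algebraMap_smul]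

lemma exists_functional_isUnit_of_notMem [IsLocalRing R] [Module.Free R M]
    {v : M} (hv : v ∉ IsLocalRing.maximalIdeal R • (⊤ : Submodule R M)) :
    ∃ g : M →ₗ[R] R, IsUnit (g v) := by
  by_contra! h
  apply hv
  let b := Module.Free.chooseBasis R M
  rw [← b.linearCombination_repr v, Finsupp.linearCombination_apply]
  exact Submodule.sum_mem _ fun i _ ↦ Submodule.smul_mem_smul
    ((IsLocalRing.mem_maximalIdeal _).mpr (h (b.coord i))) trivial

lemma apply_mem_maximalIdeal_of_mem [IsLocalRing R] (g : M →ₗ[R] R) {v : M}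
    (hv : v ∈ IsLocalRing.maximalIdeal R • (⊤ : Submodule R M)) :
    g v ∈ IsLocalRing.maximalIdeal R := by
  induction hv using Submodule.smul_induction_on' with
  | smul r hr m _ => simpa using Ideal.mul_mem_right _ _ hr
  | add a _ b _ ha hb => simpa using add_mem ha hb

/-- Over a local ring two unimodular vectors have a common unimodular functional. -/
lemma exists_functional_isUnit_isUnit [IsLocalRing R] {u v : M} {g h : M →ₗ[R] R}
    (hg : IsUnit (g v)) (hh : IsUnit (h u)) :
    ∃ l : M →ₗ[R] R, l v = 1 ∧ IsUnit (l u) := by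
  obtain ⟨l, hv, hu⟩ : ∃ l : M →ₗ[R] R, IsUnit (l v) ∧ IsUnit (l u) := by
    by_cases hgu : IsUnit (g u)
    · exact ⟨g, hg, hgu⟩
    by_cases hhv : IsUnit (h v)
    · exact ⟨h, hhv, hh⟩
    refine ⟨g + h, ?_, ?_⟩
    · rw [LinearMap.add_apply]
      by_contra hn
      exact (IsLocalRing.mem_maximalIdeal _).mp
        ((add_sub_cancel_right (g v) (h v)) ▸ Ideal.sub_mem (IsLocalRing.maximalIdeal R) hn hhv) hg
    · rw [LinearMap.add_apply]
      by_contra hn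
      exact (IsLocalRing.mem_maximalIdeal _).mp
        ((add_sub_cancel_left (g u) (h u)) ▸ Ideal.sub_mem (IsLocalRing.maximalIdeal R) hn hgu) hh
  obtain ⟨c, hc⟩ := hv.exists_left_inv
  refine ⟨c • l, by simpa using hc, ?_⟩
  simpa using (IsUnit.of_mul_eq_one _ hc).mul hu

variable {P : Type*} [AddCommGroup P] [Module A P]

/-- The map `P × A × (A ⊗ M) → A ⊗ M` given by `ψ`, the constant vector `v` and the
pencil `x - T`. -/
noncomputable def pencilExt (x : A) (ψ : P →ₗ[A] A ⊗[R] M) (v : M) (T : M →ₗ[R] M) :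
    P × A × (A ⊗[R] M) →ₗ[A] A ⊗[R] M :=
  ψ.coprod ((LinearMap.toSpanSingleton A _ ((1 : A) ⊗ₜ[R] v)).coprod (pencil x T))

lemma pencilExt_apply (x : A) (ψ : P →ₗ[A] A ⊗[R] M) (v : M) (T : M →ₗ[R] M)
    (z : P × A × (A ⊗[R] M)) :
    pencilExt x ψ v T z = ψ z.1 + (z.2.1 ⊗ₜ[R] v + pencil x T z.2.2) := by
  simp [pencilExt, TensorProduct.smul_tmul']

/-- Changing the constant vector by the image of `P` and of the pencil does not change the kernel
up to isomorphism. -/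
lemma exists_ker_pencilExt_equiv_of_add (x : A) (ψ : P →ₗ[A] A ⊗[R] M) (v w : M) (T : M →ₗ[R] M)
    (p₀ : P) (y₀ : A ⊗[R] M)
    (h : ψ p₀ + pencil x T y₀ + (1 : A) ⊗ₜ[R] v = (1 : A) ⊗ₜ[R] w)
    (hs : Function.Surjective (pencilExt x ψ v T)) :
    Function.Surjective (pencilExt x ψ w T) ∧
      Nonempty (LinearMap.ker (pencilExt x ψ w T) ≃ₗ[A] LinearMap.ker (pencilExt x ψ v T)) := by
  have key (p : P) (a : A) (y : A ⊗[R] M) :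
      pencilExt x ψ v T (p + a • p₀, a, y + a • y₀) = pencilExt x ψ w T (p, a, y) := by
    have ha (u : M) : a ⊗ₜ[R] u = a • ((1 : A) ⊗ₜ[R] u) := by simp [TensorProduct.smul_tmul']
    simp only [pencilExt_apply, map_add, map_smul]
    rw [ha w, ← h, ha v]
    simp only [smul_add]
    abel
  have key' (p : P) (a : A) (y : A ⊗[R] M) :
      pencilExt x ψ w T (p - a • p₀, a, y - a • y₀) = pencilExt x ψ v T (p, a, y) := by
    rw [← key]; simp
  refine ⟨fun z ↦ ?_, ⟨LinearEquiv.ofLinearMap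
    { toFun := fun z ↦ ⟨(z.1.1 + z.1.2.1 • p₀, z.1.2.1, z.1.2.2 + z.1.2.1 • y₀), ?_⟩
      map_add' := ?_
      map_smul' := ?_ }
    { toFun := fun z ↦ ⟨(z.1.1 - z.1.2.1 • p₀, z.1.2.1, z.1.2.2 - z.1.2.1 • y₀), ?_⟩
      map_add' := ?_
      map_smul' := ?_ } ?_ ?_⟩⟩
  · obtain ⟨⟨p, a, y⟩, hz⟩ := hs z
    exact ⟨_, (key' p a y).trans hz⟩
  · rw [LinearMap.mem_ker, key]; exact z.2
  · intro z w
    ext <;> simp [add_smul] <;> abel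
  · intro c z
    ext <;> simp [mul_smul]
  · rw [LinearMap.mem_ker, key']; exact z.2
  · intro z w
    ext <;> simp [add_smul] <;> abel
  · intro c z
    ext <;> simp [mul_smul, smul_sub]
  · ext <;> simp
  · ext <;> simp

/-- If the constant vector `v` spans a direct summand of `M` with complement `M'`, then the row
and the column of `v` may be eliminated from the extended pencil. -/
lemma exists_ker_pencilExt_equiv_of_split {M' : Type*} [AddCommGroup M'] [Module R M']
    (x : A) (ψ : P →ₗ[A] A ⊗[R] M) (v : M) (T : M →ₗ[R] M)
    (g : M →ₗ[R] R) (i : M' →ₗ[R] M) (π : M →ₗ[R] M')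
    (hgv : g v = 1) (hgi : ∀ m, g (i m) = 0) (hπv : π v = 0) (hπi : ∀ m, π (i m) = m)
    (hsum : ∀ m, m = g m • v + i (π m))
    (hs : Function.Surjective (pencilExt x ψ v T)) :
    Function.Surjective (pencilExt x (π.baseChange A ∘ₗ ψ) (-π (T v)) (π ∘ₗ T ∘ₗ i)) ∧
      Nonempty (LinearMap.ker (pencilExt x ψ v T) ≃ₗ[A]
        LinearMap.ker (pencilExt x (π.baseChange A ∘ₗ ψ) (-π (T v)) (π ∘ₗ T ∘ₗ i))) := by
  let G : A ⊗[R] M →ₗ[A] A := (TensorProduct.AlgebraTensorModule.rid R A A).toLinearMap ∘ₗ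
    g.baseChange A
  have hGt (a : A) (m : M) : G (a ⊗ₜ m) = g m • a := by simp [G]
  have hGi (y : A ⊗[R] M') : G (i.baseChange A y) = 0 := by
    induction y with
    | zero => simp
    | tmul a m => simp [hGt, hgi]
    | add a b ha hb => simp [ha, hb]
  have hpii (y : A ⊗[R] M') : π.baseChange A (i.baseChange A y) = y := by
    induction y with
    | zero => simp
    | tmul a m => simp [hπi]
    | add a b ha hb => simp [ha, hb]
  have hdec (y : A ⊗[R] M) : y = G y ⊗ₜ[R] v + i.baseChange A (π.baseChange A y) := by
    induction y with
    | zero => simp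
    | tmul a m =>
      conv_lhs => rw [hsum m]
      simp [hGt, TensorProduct.tmul_add, TensorProduct.smul_tmul]
    | add a b ha hb =>
      conv_lhs => rw [ha, hb]
      simp only [map_add, TensorProduct.add_tmul]
      abel
  have key (p : P) (a : A) (y : A ⊗[R] M) :
      pencilExt x (π.baseChange A ∘ₗ ψ) (-π (T v)) (π ∘ₗ T ∘ₗ i) (p, G y, π.baseChange A y) =
        π.baseChange A (pencilExt x ψ v T (p, a, y)) := by
    have h : π.baseChange A (T.baseChange A y) = G y ⊗ₜ[R] π (T v) +
        π.baseChange A (T.baseChange A (i.baseChange A (π.baseChange A y))) := by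
      conv_lhs => rw [hdec y]
      simp
    simp only [pencilExt_apply, pencil_apply, map_add, map_sub, map_smul, h,
      LinearMap.baseChange_tmul, hπv, LinearMap.baseChange_comp, LinearMap.comp_apply,
      TensorProduct.tmul_neg, TensorProduct.tmul_zero]
    abel
  have key2 (p : P) (a : A) (y : A ⊗[R] M) :
      G (pencilExt x ψ v T (p, a, y)) = G (ψ p) + a + G (pencil x T y) := by
    simp [pencilExt_apply, hGt, hgv, add_assoc]
  have hGsum (b : A) (y : A ⊗[R] M') : G (b ⊗ₜ[R] v + i.baseChange A y) = b := by
    simp [hGt, hgv, hGi]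
  have hpisum (b : A) (y : A ⊗[R] M') :
      π.baseChange A (b ⊗ₜ[R] v + i.baseChange A y) = y := by
    simp [hπv, hpii]
  refine ⟨fun z ↦ ?_, ⟨LinearEquiv.ofLinearMap
    { toFun := fun z ↦ ⟨(z.1.1, G z.1.2.2, π.baseChange A z.1.2.2), ?_⟩
      map_add' := ?_
      map_smul' := ?_ }
    { toFun := fun z ↦ ⟨(z.1.1, - (G (ψ z.1.1) +
          G (pencil x T (z.1.2.1 ⊗ₜ[R] v + i.baseChange A z.1.2.2))),
          z.1.2.1 ⊗ₜ[R] v + i.baseChange A z.1.2.2), ?_⟩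
      map_add' := ?_
      map_smul' := ?_ } ?_ ?_⟩⟩
  · obtain ⟨⟨p, a, y⟩, hz⟩ := hs (i.baseChange A z)
    exact ⟨(p, G y, π.baseChange A y), by rw [key p a y, hz, hpii]⟩
  · rw [LinearMap.mem_ker, key _ z.1.2.1, (z.2 : pencilExt x ψ v T z.1 = 0), map_zero]
  · intro z w
    ext <;> simp
  · intro c z
    ext <;> simp
  · have hz : pencilExt x (π.baseChange A ∘ₗ ψ) (-π (T v)) (π ∘ₗ T ∘ₗ i) z.1 = 0 := z.2
    rw [LinearMap.mem_ker, hdec (pencilExt _ _ _ _ _), ← key, key2, hGsum, hpisum, hz]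
    simp
  · intro z w
    refine Subtype.ext (Prod.ext rfl (Prod.ext ?_ ?_))
    · simp only [Submodule.coe_add, Prod.fst_add, Prod.snd_add, map_add, TensorProduct.add_tmul]
      abel
    · simp only [Submodule.coe_add, Prod.fst_add, Prod.snd_add, map_add, TensorProduct.add_tmul]
      abel
  · intro c z
    have ht : (c * z.1.2.1) ⊗ₜ[R] v = c • (z.1.2.1 ⊗ₜ[R] v) := by
      rw [TensorProduct.smul_tmul', smul_eq_mul]
    refine Subtype.ext (Prod.ext rfl (Prod.ext ?_ ?_))
    · simp only [Submodule.coe_smul, Prod.smul_fst, Prod.smul_snd, smul_eq_mul, ht, map_smul,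
        map_add, RingHom.id_apply]
      ring
    · simp [ht]
  · ext1 z
    refine Subtype.ext (Prod.ext rfl (Prod.ext ?_ ?_))
    · exact hGsum _ _
    · exact hpisum _ _
  · ext1 z
    have hz : pencilExt x ψ v T z.1 = 0 := z.2
    refine Subtype.ext (Prod.ext rfl (Prod.ext ?_ ?_))
    · have h := key2 z.1.1 z.1.2.1 z.1.2.2
      have h' : G (pencilExt x ψ v T z.1) = 0 := by rw [hz, map_zero]
      change G (pencilExt x ψ v T z.1) = _ at h
      rw [h'] at h
      change - (G (ψ z.1.1) + G (pencil x T (G z.1.2.2 ⊗ₜ[R] v +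
        i.baseChange A (π.baseChange A z.1.2.2)))) = z.1.2.1
      rw [← hdec]
      linear_combination h
    · exact (hdec _).symm

lemma exists_tmul_sub_mem_range_pencil_of_mem_smul_top (I : Ideal R) (x : A)
    (hx : ∀ a : A, ∃ (n : ℕ) (q : R[X]), x ^ n * a = aeval x q)
    (T : M →ₗ[R] M) (hT : Function.Surjective T) (a : A) {v : M}
    (hv : v ∈ I • (⊤ : Submodule R M)) :
    ∃ r ∈ I • (⊤ : Submodule R M), a ⊗ₜ[R] v - (1 : A) ⊗ₜ[R] r ∈ LinearMap.range (pencil x T) := by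
  induction hv using Submodule.smul_induction_on' with
  | smul c hc m _ =>
    obtain ⟨m', hm'⟩ := exists_sub_mem_range_pencil x hx T hT (a ⊗ₜ[R] m)
    refine ⟨c • m', Submodule.smul_mem_smul hc trivial, ?_⟩
    have h := Submodule.smul_mem _ (algebraMap R A c) hm'
    rwa [algebraMap_smul, smul_sub, ← TensorProduct.tmul_smul, ← TensorProduct.tmul_smul] at h
  | add u _ v _ hu hv =>
    obtain ⟨r, hr, h⟩ := hu
    obtain ⟨s, hs, h'⟩ := hv
    refine ⟨r + s, add_mem hr hs, ?_⟩
    convert add_mem h h' using 1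
    rw [TensorProduct.tmul_add, TensorProduct.tmul_add]
    abel

/-- The constant vector of a surjective extended pencil over a local ring may be made unimodular. -/
lemma exists_isUnit_ker_pencilExt_equiv [IsLocalRing R] [Module.Free R M] [Nontrivial M] (x : A)
    (hx : ∀ a : A, ∃ (n : ℕ) (q : R[X]), x ^ n * a = aeval x q)
    (ψ : P →ₗ[A] A ⊗[R] M) (v : M) (T : M →ₗ[R] M) (hT : Function.Surjective T)
    (hs : Function.Surjective (pencilExt x ψ v T)) :
    ∃ w : M, (∃ g : M →ₗ[R] R, IsUnit (g w)) ∧ Function.Surjective (pencilExt x ψ w T) ∧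
      Nonempty (LinearMap.ker (pencilExt x ψ w T) ≃ₗ[A] LinearMap.ker (pencilExt x ψ v T)) := by
  by_cases hv : v ∈ IsLocalRing.maximalIdeal R • (⊤ : Submodule R M)
  swap
  · exact ⟨v, exists_functional_isUnit_of_notMem hv, hs, ⟨LinearEquiv.refl _ _⟩⟩
  let b := Module.Free.chooseBasis R M
  obtain ⟨i⟩ := b.index_nonempty
  obtain ⟨⟨p₀, a, y₀⟩, h⟩ := hs ((1 : A) ⊗ₜ[R] b i)
  obtain ⟨r, hr, y₁, hy₁⟩ := exists_tmul_sub_mem_range_pencil_of_mem_smul_top _ x hx T hT a hv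
  refine ⟨b i - r + v, ⟨b.coord i, ?_⟩,
    exists_ker_pencilExt_equiv_of_add x ψ v _ T p₀ (y₀ + y₁) ?_ hs⟩
  · rw [sub_add, map_sub]
    by_contra hn
    have h1 := Ideal.add_mem (IsLocalRing.maximalIdeal R) ((IsLocalRing.mem_maximalIdeal _).mpr hn)
      (apply_mem_maximalIdeal_of_mem (b.coord i) (sub_mem hr hv))
    rw [sub_add_cancel, IsLocalRing.mem_maximalIdeal] at h1
    exact h1 (by simp)
  · rw [pencilExt_apply] at h
    simp only at h
    rw [map_add, hy₁, TensorProduct.tmul_add, TensorProduct.tmul_sub, ← h]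
    abel

/-- The kernel of a surjective extended pencil over a local ring. -/
theorem nonempty_ker_pencilExt_equiv_prod [IsLocalRing R] (x : A)
    (hx : ∀ a : A, ∃ (n : ℕ) (q : R[X]), x ^ n * a = aeval x q) (n : ℕ) :
    ∀ (M : Type*) [AddCommGroup M] [Module R M] [Module.Free R M] [Module.Finite R M]
      (_ : Module.finrank R M = n) (ψ : P →ₗ[A] A ⊗[R] M) (v : M) (T : M →ₗ[R] M)
      (_ : Function.Bijective T) (_ : Function.Surjective (pencilExt x ψ v T)),
      Nonempty (LinearMap.ker (pencilExt x ψ v T) ≃ₗ[A] P × A) := by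
  induction n with
  | zero =>
    intro M _ _ _ _ hM ψ v T _ _
    have : Subsingleton M := (Module.finrank_eq_zero_iff_of_free R M).mp hM
    exact ⟨(LinearEquiv.ofTop _ (by ext; simp [Subsingleton.elim _ (0 : A ⊗[R] M)])) ≪≫ₗ
      LinearEquiv.prodCongr (LinearEquiv.refl A P) (LinearEquiv.prodUnique (R := A))⟩
  | succ n ih =>
    intro M _ _ _ _ hM ψ v₀ T hT hs₀
    have : Nontrivial M := Module.nontrivial_of_finrank_pos (R := R) (by omega)
    obtain ⟨v, ⟨g₀, hg₀⟩, hs, ⟨e₀⟩⟩ := exists_isUnit_ker_pencilExt_equiv x hx ψ v₀ T hT.2 hs₀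
    obtain ⟨u, hu⟩ := hT.2 v
    obtain ⟨g, hgv, hgu⟩ := exists_functional_isUnit_isUnit (u := u) (h := g₀ ∘ₗ T) hg₀
      (by simpa [hu] using hg₀)
    let i : LinearMap.ker g →ₗ[R] M := (LinearMap.ker g).subtype
    let π : M →ₗ[R] LinearMap.ker g :=
      (LinearMap.id - g.smulRight v).codRestrict _ fun m ↦ by simp [hgv]
    have hπ (m : M) : (π m : M) = m - g m • v := rfl
    have hgi (m) : g (i m) = 0 := m.2
    have hπi (m) : π (i m) = m := Subtype.ext (by rw [hπ, hgi]; simp [i])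
    have : Module.Projective R (LinearMap.ker g) :=
      Module.Projective.of_split i π (LinearMap.ext hπi)
    have : Module.Finite R (LinearMap.ker g) :=
      Module.Finite.of_surjective π fun m ↦ ⟨i m, hπi m⟩
    have : Module.Free R (LinearMap.ker g) := Module.free_of_flat_of_isLocalRing
    have hrank : Module.finrank R (LinearMap.ker g) = n := by
      let e : M ≃ₗ[R] R × LinearMap.ker g := LinearEquiv.ofLinearMap (g.prod π)
        ((LinearMap.toSpanSingleton R M v).coprod i)
        (by
          ext
          · simp [hgv]
          · simp [hπ, hgv]
          · simpa using hgi _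
          · simpa using congr_arg Subtype.val (hπi _))
        (by ext m; simp [hπ, i])
      have := e.finrank_eq
      rw [Module.finrank_prod, Module.finrank_self] at this
      omega
    have hπv : π v = 0 := Subtype.ext (by simp [hπ, hgv])
    obtain ⟨hs', ⟨e₁⟩⟩ := exists_ker_pencilExt_equiv_of_split x ψ v T g i π hgv hgi hπv hπi
      (fun m ↦ by simp [i, hπ]) hs
    suffices hbij : Function.Bijective (π ∘ₗ T ∘ₗ i) by
      obtain ⟨e₂⟩ := ih (LinearMap.ker g) hrank _ _ _ hbij hs'
      exact ⟨e₀.symm ≪≫ₗ e₁ ≪≫ₗ e₂⟩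
    constructor
    · rw [injective_iff_map_eq_zero]
      intro y hy
      have h1 : T y = T (g (T y) • u) := by
        rw [map_smul, hu, ← sub_eq_zero]
        exact congr_arg Subtype.val hy
      have h2 := hT.1 h1
      have h3 : g (T y) * g u = 0 := by
        rw [← smul_eq_mul, ← map_smul, ← h2]
        exact y.2
      rw [hgu.mul_left_eq_zero] at h3
      rw [h3, zero_smul] at h2
      exact Subtype.ext h2
    · intro z
      obtain ⟨t, ht⟩ := hT.2 z
      obtain ⟨c, hc⟩ := hgu.exists_left_inv
      refine ⟨⟨t - (g t * c) • u, ?_⟩, ?_⟩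
      · simp [mul_assoc, hc]
      · change π (T (t - (g t * c) • u)) = z
        rw [map_sub, map_smul, map_sub, map_smul, hu, hπv, ht, smul_zero, sub_zero]
        exact hπi z

end Pencil

section Reduction

lemma mem_map_C_iff_map_mk_eq_zero {R : Type*} [CommRing R] (I : Ideal R) (q : R[X]) :
    q ∈ I.map C ↔ q.map (Ideal.Quotient.mk I) = 0 := by
  simp [Ideal.mem_map_C_iff, Polynomial.ext_iff, Ideal.Quotient.eq_zero_iff_mem]

variable {R A : Type*} [CommRing R] [CommRing A] [Algebra R A]
  {x : A} (hx : IsLaurentVariable R x) {f : R[X]} (hf : IsSpecialMonic f) (I : Ideal R)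

include hx

lemma IsLaurentVariable.exists_pow_mul_of_mem_smul_top {a : A}
    (ha : a ∈ I • (⊤ : Submodule R A)) :
    ∃ (n : ℕ) (q : R[X]), q ∈ I.map C ∧ x ^ n * a = aeval x q := by
  induction ha using Submodule.smul_induction_on' with
  | smul r hr a _ =>
    obtain ⟨n, q, hq⟩ := hx.exists_pow_mul a
    refine ⟨n, C r * q, Ideal.mul_mem_right _ _ (Ideal.mem_map_of_mem C hr), ?_⟩
    rw [mul_smul_comm, hq, map_mul, aeval_C, Algebra.smul_def]
  | add a _ b _ ha hb =>
    obtain ⟨m, p, hp, hpa⟩ := ha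
    obtain ⟨n, q, hq, hqb⟩ := hb
    refine ⟨m + n, X ^ n * p + X ^ m * q,
      add_mem (Ideal.mul_mem_left _ _ hp) (Ideal.mul_mem_left _ _ hq), ?_⟩
    simp only [map_add, map_mul, map_pow, aeval_X, ← hpa, ← hqb]
    ring

include hf

lemma IsLaurentVariable.mem_smul_top_of_aeval_mul_mem {a : A}
    (ha : aeval x f * a ∈ I • (⊤ : Submodule R A)) : a ∈ I • (⊤ : Submodule R A) := by
  obtain ⟨n, q, hq⟩ := hx.exists_pow_mul a
  obtain ⟨m, p, hp, hpa⟩ := hx.exists_pow_mul_of_mem_smul_top I ha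
  have h : f * (X ^ m * q) = X ^ n * p := hx.aeval_injective (by
    simp only [map_mul, map_pow, aeval_X, ← hpa, ← hq]
    ring)
  have hq' : X ^ m * q ∈ I.map C := by
    have hz : (X ^ m * q).map (Ideal.Quotient.mk I) = 0 := by
      have h' := congr_arg (Polynomial.map (Ideal.Quotient.mk I)) h
      rw [Polynomial.map_mul, Polynomial.map_mul (p := X ^ n),
        (mem_map_C_iff_map_mk_eq_zero I p).mp hp] at h'
      rwa [mul_zero, (hf.1.map _).mul_right_eq_zero_iff] at h'
    exact (mem_map_C_iff_map_mk_eq_zero I _).mpr hz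
  have hmem : x ^ (m + n) * a ∈ I • (⊤ : Submodule R A) := by
    rw [pow_add, mul_assoc, hq, Ideal.smul_top_eq_map]
    have hle : I.map C ≤ (I.map (algebraMap R A)).comap (aeval (R := R) x) :=
      Ideal.map_le_iff_le_comap.mpr fun r hr ↦ by
        simpa using Ideal.mem_map_of_mem (algebraMap R A) hr
    simpa using hle hq'
  obtain ⟨g, h, hgh⟩ := hf.exists_mul_pow_add_mul x (m + n)
  have hadd : a = aeval x g * (x ^ (m + n) * a) + aeval x h * (aeval x f * a) := by
    linear_combination (-a) * hgh
  rw [Ideal.smul_top_eq_map, Submodule.restrictScalars_mem] at ha hmem ⊢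
  rw [hadd]
  exact add_mem (Ideal.mul_mem_left _ _ hmem) (Ideal.mul_mem_left _ _ ha)

lemma IsLaurentVariable.mem_smul_top_of_aeval_smul_mem {P : Type*} [AddCommGroup P] [Module A P]
    [Module R P] [IsScalarTower R A P] [Module.Finite A P] [Module.Projective A P] {y : P}
    (hy : aeval x f • y ∈ I • (⊤ : Submodule R P)) : y ∈ I • (⊤ : Submodule R P) := by
  obtain ⟨n, π, s, -, -, hπs⟩ := Module.Finite.exists_comp_eq_id_of_projective A P
  have hs (i : Fin n) : s y i ∈ I • (⊤ : Submodule R A) := by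
    apply hx.mem_smul_top_of_aeval_mul_mem hf
    have := Submodule.smul_top_le_comap_smul_top I
      ((LinearMap.proj i ∘ₗ s : P →ₗ[A] A).restrictScalars R) hy
    simpa using this
  have hsum : y = ∑ i, s y i • π (Pi.single i 1) := by
    conv_lhs => rw [← LinearMap.id_apply (R := A) y, ← hπs, LinearMap.comp_apply,
      pi_eq_sum_univ' (s y), map_sum]
    simp only [map_smul]
  rw [hsum]
  exact sum_mem fun i _ ↦ Submodule.smul_top_le_comap_smul_top I
    ((LinearMap.toSpanSingleton A P (π (Pi.single i 1))).restrictScalars R) (hs i)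

end Reduction

section Cokernel

lemma projective_of_projective_algebra (R S N : Type*) [CommRing R] [CommRing S] [Algebra R S]
    [AddCommGroup N] [Module R N] [Module S N] [IsScalarTower R S N]
    [Module.Free R S] [Module.Projective S N] : Module.Projective R N := by
  obtain ⟨s, hs⟩ := Module.projective_def'.mp (inferInstance : Module.Projective S N)
  exact Module.Projective.of_split (s.restrictScalars R)
    ((Finsupp.linearCombination S (id : N → N)).restrictScalars R)
    (LinearMap.ext fun y ↦ LinearMap.congr_fun hs y)

variable {R A : Type*} [CommRing R] [CommRing A] [Algebra R A]
  {P Q : Type*} [AddCommGroup P] [Module A P] [Module R P] [IsScalarTower R A P]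
  [AddCommGroup Q] [Module A Q] [Module R Q] [IsScalarTower R A Q]

lemma projective_quotient_smul_top (I : Ideal A) [Module.Free R (A ⧸ I)]
    [Module.Projective A Q] : Module.Projective R (Q ⧸ (I • (⊤ : Submodule A Q))) := by
  have : Module.Projective R ((A ⧸ I) ⊗[A] Q) := projective_of_projective_algebra R (A ⧸ I) _
  exact Module.Projective.of_equiv ((quotTensorEquivQuotSMul Q I).restrictScalars R)

lemma finite_quotient_smul_top (I : Ideal A) [Module.Finite R (A ⧸ I)]
    [Module.Finite A Q] : Module.Finite R (Q ⧸ (I • (⊤ : Submodule A Q))) := by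
  have : Module.Finite R ((A ⧸ I) ⊗[A] Q) := Module.Finite.trans (A ⧸ I) _
  exact Module.Finite.equiv ((quotTensorEquivQuotSMul Q I).restrictScalars R)

lemma one_tmul_eq_zero_iff_mem_smul_top {N : Type*} [AddCommGroup N] [Module R N] (I : Ideal R)
    (y : N) : (1 : R ⧸ I) ⊗ₜ[R] y = 0 ↔ y ∈ I • (⊤ : Submodule R N) := by
  rw [← (quotTensorEquivQuotSMul N I).map_eq_zero_iff, ← map_one (Ideal.Quotient.mk I),
    quotTensorEquivQuotSMul_mk_tmul, one_smul, Submodule.Quotient.mk_eq_zero]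

variable [IsLocalRing R]

/-- A map into a finite free module over a local ring whose source is finite and which is
injective modulo the maximal ideal has projective source. -/
lemma projective_of_smul_top_comap_le {E Y : Type*} [AddCommGroup E] [Module R E]
    [AddCommGroup Y] [Module R Y] [Module.Finite R E] [Module.Finite R Y] [Module.Projective R Y]
    (l : E →ₗ[R] Y) (hl : (IsLocalRing.maximalIdeal R • (⊤ : Submodule R Y)).comap l ≤
      IsLocalRing.maximalIdeal R • (⊤ : Submodule R E)) : Module.Projective R E := by
  have : Module.Free R Y := Module.free_of_flat_of_isLocalRing
  obtain ⟨l', hl'⟩ := (IsLocalRing.split_injective_iff_lTensor_residueField_injective l).mpr <| by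
    rw [injective_iff_map_eq_zero]
    intro z hz
    obtain ⟨y, rfl⟩ : ∃ y : E, (1 : IsLocalRing.ResidueField R) ⊗ₜ[R] y = z :=
      TensorProduct.mk_surjective R E _ Ideal.Quotient.mk_surjective z
    rw [LinearMap.lTensor_tmul] at hz
    exact (one_tmul_eq_zero_iff_mem_smul_top _ _).mpr
      (hl ((one_tmul_eq_zero_iff_mem_smul_top _ _).mp hz))
  exact Module.Projective.of_split l l' hl'

variable {x : A} (hx : IsLaurentVariable R x) {f : R[X]} (hf : IsSpecialMonic f)
  {u : Q →ₗ[A] P} {w : P →ₗ[A] Q} (huw : ∀ p, u (w p) = aeval x f • p)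

include hx hf huw

omit [Module R Q] [IsScalarTower R A Q] [IsLocalRing R] in
lemma IsLaurentVariable.finite_quotient_range [Module.Finite A P] :
    Module.Finite R (P ⧸ LinearMap.range u) := by
  have := hx.finite_quotient hf
  have := finite_quotient_smul_top (R := R) (Q := P) (Ideal.span {aeval x f})
  refine Module.Finite.of_surjective ((Submodule.mapQ (Ideal.span {aeval x f} • (⊤ : Submodule A P))
    (LinearMap.range u) LinearMap.id ?_).restrictScalars R) ?_
  · rw [Submodule.ideal_span_singleton_smul]
    rintro _ ⟨p, -, rfl⟩
    exact ⟨w p, huw p⟩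
  · rintro ⟨p⟩
    exact ⟨Submodule.Quotient.mk p, rfl⟩

lemma IsLaurentVariable.projective_quotient_range [Module.Finite A P] [Module.Projective A P]
    [Module.Finite A Q] [Module.Projective A Q] (hwu : ∀ q, w (u q) = aeval x f • q) :
    Module.Projective R (P ⧸ LinearMap.range u) := by
  have := hx.finite_quotient hf
  have := hx.free_quotient hf
  have := hx.finite_quotient_range hf huw
  let N : Submodule A Q := Ideal.span {aeval x f} • ⊤
  have : Module.Finite R (Q ⧸ N) := finite_quotient_smul_top _
  have : Module.Projective R (Q ⧸ N) := projective_quotient_smul_top _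
  let l : (P ⧸ LinearMap.range u) →ₗ[A] Q ⧸ N := Submodule.mapQ _ _ w <| by
    rintro _ ⟨q, rfl⟩
    rw [Submodule.mem_comap, hwu]
    exact Submodule.smul_mem_smul (Ideal.mem_span_singleton_self _) trivial
  apply projective_of_smul_top_comap_le (l.restrictScalars R)
  intro z hz
  obtain ⟨p, rfl⟩ := Submodule.Quotient.mk_surjective _ z
  set J := IsLocalRing.maximalIdeal R
  have hz' : (N.mkQ.restrictScalars R) (w p) ∈ J • (⊤ : Submodule R (Q ⧸ N)) := hz
  have hsurj : Submodule.map (N.mkQ.restrictScalars R) ⊤ = ⊤ := by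
    rw [Submodule.map_top, LinearMap.range_eq_top]
    exact N.mkQ_surjective
  rw [← hsurj, ← Submodule.map_smul''] at hz'
  obtain ⟨y, hy, hyw⟩ := hz'
  have hmem : w p - y ∈ N := by
    rw [← Submodule.Quotient.eq]
    exact hyw.symm
  rw [show N = Ideal.span {aeval x f} • ⊤ from rfl, Submodule.ideal_span_singleton_smul] at hmem
  obtain ⟨q, -, hq⟩ := hmem
  have hsub : p - u q ∈ J • (⊤ : Submodule R P) := by
    apply hx.mem_smul_top_of_aeval_smul_mem hf
    have h : aeval x f • (p - u q) = u y := by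
      rw [smul_sub, ← huw, ← map_smul, ← map_sub]
      congr 1
      rw [← sub_sub_cancel (w p) y, ← hq]
      rfl
    rw [h]
    exact Submodule.smul_top_le_comap_smul_top J (u.restrictScalars R) hy
  have h : Submodule.Quotient.mk p = (LinearMap.range u).mkQ (p - u q) := by
    symm
    rw [← sub_eq_zero, ← Submodule.mkQ_apply, ← map_sub, sub_sub_cancel_left, map_neg]
    simp
  rw [h]
  exact Submodule.smul_top_le_comap_smul_top J ((LinearMap.range u).mkQ.restrictScalars R) hsub

end Cokernel

section Core

variable {R A : Type*} [CommRing R] [CommRing A] [Algebra R A]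
  {x : A} (hx : IsLaurentVariable R x) {f : R[X]} (hf : IsSpecialMonic f)

include hx hf in
lemma IsLaurentVariable.injective_aeval_smul {P : Type*} [AddCommGroup P] [Module A P]
    [Module.Flat A P] {y : P} (hy : aeval x f • y = 0) : y = 0 :=
  (Module.Flat.isSMulRegular_of_isRegular (hx.isRegular_aeval hf)).right_eq_zero_of_smul hy

/-- If `x` is annihilated by a special monic polynomial on `E`, then `x` acts bijectively on `E`. -/
lemma IsSpecialMonic.bijective_lsmul (hf : IsSpecialMonic f) (x : A) {E : Type*} [AddCommGroup E]
    [Module A E] [Module R E] [IsScalarTower R A E] (hE : ∀ e : E, aeval x f • e = 0) :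
    Function.Bijective (Algebra.lsmul R R E x) := by
  obtain ⟨g, h, hgh⟩ := hf.exists_mul_pow_add_mul x 1
  have key (e : E) : (aeval x g * x) • e = e := by
    simpa [add_smul, mul_smul, hE] using congr_arg (· • e) hgh
  refine ⟨(injective_iff_map_eq_zero _).mpr fun e he ↦ ?_, fun e ↦ ⟨aeval x g • e, ?_⟩⟩
  · rw [← key e, mul_smul]
    exact (congr_arg _ he).trans (smul_zero _)
  · change x • aeval x g • e = e
    rw [smul_smul, mul_comm, key]

section Resolution

variable {E : Type*} [AddCommGroup E] [Module A E] [Module R E] [IsScalarTower R A E]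

lemma liftBaseChange_pencil (x : A) (y : A ⊗[R] E) :
    LinearMap.liftBaseChange A LinearMap.id (pencil x (Algebra.lsmul R R E x) y) = 0 := by
  induction y with
  | zero => simp
  | add y z hy hz => rw [map_add, map_add, hy, hz, add_zero]
  | tmul a e => simp [pencil_apply, TensorProduct.smul_tmul', smul_smul, mul_comm]

include hx

lemma IsLaurentVariable.mem_range_pencil
    (hT : Function.Surjective (Algebra.lsmul R R E x)) {y : A ⊗[R] E}
    (hy : LinearMap.liftBaseChange A LinearMap.id y = (0 : E)) :
    y ∈ LinearMap.range (pencil x (Algebra.lsmul R R E x)) := by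
  obtain ⟨m, hm⟩ := exists_sub_mem_range_pencil x hx.exists_pow_mul _ hT y
  obtain ⟨z, hz⟩ := hm
  have h := liftBaseChange_pencil x z
  rw [hz, map_sub, hy] at h
  have hm0 : m = 0 := by simpa using h
  rw [hm0, TensorProduct.tmul_zero, sub_zero] at hz
  exact ⟨z, hz⟩

include hf in
lemma IsLaurentVariable.injective_pencil [Module.Flat R E] (hE : ∀ e : E, aeval x f • e = 0) :
    Function.Injective (pencil x (Algebra.lsmul R R E x)) := by
  rw [injective_iff_map_eq_zero]
  intro y hy
  apply hx.injective_aeval_smul hf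
  have h0 : aeval (Algebra.lsmul R R E x) f = 0 := by
    ext e
    rw [aeval_algHom_apply]
    exact hE e
  rw [aeval_smul_eq_of_pencil_eq_zero x _ f hy, h0]
  simp

end Resolution

/-- Horrocks's theorem for modules with a free summand of rank one: inclusions of finite projective
modules with cokernel killed by a special monic polynomial force an isomorphism. -/
theorem IsLaurentVariable.nonempty_equiv_prod [IsLocalRing R] (hx : IsLaurentVariable R x)
    (hf : IsSpecialMonic f)
    {P Q : Type*} [AddCommGroup P] [Module A P] [Module R P] [IsScalarTower R A P]
    [Module.Finite A P] [Module.Projective A P]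
    [AddCommGroup Q] [Module A Q] [Module R Q] [IsScalarTower R A Q]
    [Module.Finite A Q] [Module.Projective A Q]
    (u : Q →ₗ[A] P × A) (w : P × A →ₗ[A] Q) (huw : ∀ p, u (w p) = aeval x f • p)
    (hwu : ∀ q, w (u q) = aeval x f • q) : Nonempty (Q ≃ₗ[A] P × A) := by
  let E := (P × A) ⧸ LinearMap.range u
  have := hx.finite_quotient_range hf huw
  have := hx.projective_quotient_range hf huw hwu
  have : Module.Free R E := Module.free_of_flat_of_isLocalRing
  have hE (e : E) : aeval x f • e = 0 := by
    obtain ⟨p, rfl⟩ := Submodule.Quotient.mk_surjective _ e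
    rw [← Submodule.Quotient.mk_smul, Submodule.Quotient.mk_eq_zero]
    exact ⟨w p, huw p⟩
  let T : E →ₗ[R] E := Algebra.lsmul R R E x
  have hT : Function.Bijective T := hf.bijective_lsmul x hE
  let ε : A ⊗[R] E →ₗ[A] E := LinearMap.liftBaseChange A LinearMap.id
  have hε : Function.Surjective ε := fun e ↦ ⟨1 ⊗ₜ e, by simp [ε]⟩
  obtain ⟨φ, hφ⟩ := Module.projective_lifting_property ε (LinearMap.range u).mkQ hε
  have hφ' (p : P × A) : ε (φ p) = (LinearMap.range u).mkQ p := LinearMap.congr_fun hφ p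
  obtain ⟨v, y₀, hy₀⟩ := exists_sub_mem_range_pencil x hx.exists_pow_mul T hT.2 (φ (0, 1))
  let ψ : P →ₗ[A] A ⊗[R] E := φ ∘ₗ LinearMap.inl A P A
  have hφψ (p : P) (a : A) : φ (p, a) = ψ p + (a ⊗ₜ[R] v + pencil x T (a • y₀)) := by
    have h : (p, a) = LinearMap.inl A P A p + a • ((0, 1) : P × A) := by simp
    rw [h, map_add, map_smul, map_smul, hy₀, smul_sub, TensorProduct.smul_tmul', smul_eq_mul,
      mul_one, add_sub_cancel]
    rfl
  have hεp (y : A ⊗[R] E) : ε (pencil x T y) = 0 := liftBaseChange_pencil x y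
  have hext (z : P × A × (A ⊗[R] E)) :
      pencilExt x ψ v T z = φ (z.1, z.2.1) + pencil x T (z.2.2 - z.2.1 • y₀) := by
    rw [pencilExt_apply, hφψ, map_sub]
    abel
  have hs : Function.Surjective (pencilExt x ψ v T) := by
    intro y
    obtain ⟨⟨p, a⟩, hp⟩ := (LinearMap.range u).mkQ_surjective (ε y)
    obtain ⟨z, hz⟩ := hx.mem_range_pencil hT.2 (y := y - φ (p, a)) (by
      change ε (y - φ (p, a)) = 0
      rw [map_sub, hφ', hp, sub_self])
    refine ⟨(p, a, z + a • y₀), ?_⟩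
    rw [hext, add_sub_cancel_right]
    change _ + pencil x (Algebra.lsmul R R E x) z = _
    rw [hz, add_sub_cancel]
  obtain ⟨e⟩ := nonempty_ker_pencilExt_equiv_prod x hx.exists_pow_mul _ E rfl ψ v T hT hs
  let π : LinearMap.ker (pencilExt x ψ v T) →ₗ[A] P × A :=
    ((LinearMap.fst A P _).prod (LinearMap.fst A A _ ∘ₗ LinearMap.snd A P _)) ∘ₗ
      Submodule.subtype _
  have hπ (z) : π z = (z.1.1, z.1.2.1) := rfl
  have hπinj : Function.Injective π := by
    rw [injective_iff_map_eq_zero]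
    rintro ⟨⟨p, a, y⟩, hz⟩ h
    rw [hπ, Prod.mk_eq_zero] at h
    obtain ⟨rfl, rfl⟩ : p = 0 ∧ a = 0 := h
    have hy : pencil x T y = 0 := by
      simpa [pencilExt_apply] using hz
    have hy' : y = 0 := hx.injective_pencil hf hE (hy.trans (map_zero _).symm)
    subst hy'
    rfl
  have hπrange : LinearMap.range π = LinearMap.range u := by
    ext p
    rw [← Submodule.Quotient.mk_eq_zero (LinearMap.range u), ← Submodule.mkQ_apply, ← hφ']
    constructor
    · rintro ⟨z, rfl⟩
      have h := congr_arg ε ((hext z.1).symm.trans z.2)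
      rwa [map_add, hεp, map_zero, add_zero] at h
    · intro h
      obtain ⟨y, hy⟩ := hx.mem_range_pencil hT.2 h
      refine ⟨⟨(p.1, p.2, p.2 • y₀ - y), ?_⟩, rfl⟩
      rw [LinearMap.mem_ker, hext, sub_sub_cancel_left, map_neg]
      change _ + - pencil x (Algebra.lsmul R R E x) y = _
      rw [hy, add_neg_cancel]
  have hu : Function.Injective u := by
    rw [injective_iff_map_eq_zero]
    intro q hq
    apply hx.injective_aeval_smul hf
    rw [← hwu, hq, map_zero]
  exact ⟨(LinearEquiv.ofInjective u hu).trans ((LinearEquiv.ofEq _ _ hπrange.symm).trans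
    ((LinearEquiv.ofInjective π hπinj).symm.trans e))⟩

end Core

section Localization

lemma mkLinearMap_powers_injective {A M : Type*} [CommRing A] [AddCommGroup M] [Module A M]
    (a : A) (ha : IsSMulRegular M a) :
    Function.Injective (LocalizedModule.mkLinearMap (Submonoid.powers a) M) := by
  rw [injective_iff_map_eq_zero]
  intro m hm
  obtain ⟨⟨_, n, rfl⟩, hn⟩ := (IsLocalizedModule.eq_zero_iff (Submonoid.powers a) _).mp hm
  exact (ha.pow n).right_eq_zero_of_smul hn

/-- An isomorphism of finitely presented modules after inverting `a` comes from maps in both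
directions whose composites are multiplication by a power of `a`. -/
lemma exists_comp_eq_pow_smul_of_localizedModule_equiv {A P Q : Type*} [CommRing A]
    [AddCommGroup P] [Module A P] [Module.FinitePresentation A P]
    [AddCommGroup Q] [Module A Q] [Module.FinitePresentation A Q] (a : A)
    (haP : IsSMulRegular P a) (haQ : IsSMulRegular Q a)
    (e : LocalizedModule (Submonoid.powers a) P ≃ₗ[Localization (Submonoid.powers a)]
      LocalizedModule (Submonoid.powers a) Q) :
    ∃ (n : ℕ) (u : Q →ₗ[A] P) (w : P →ₗ[A] Q),
      (∀ p, u (w p) = a ^ n • p) ∧ ∀ q, w (u q) = a ^ n • q := by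
  let S := Submonoid.powers a
  let mP := LocalizedModule.mkLinearMap S P
  let mQ := LocalizedModule.mkLinearMap S Q
  have hP : Function.Injective mP := mkLinearMap_powers_injective a haP
  have hQ : Function.Injective mQ := mkLinearMap_powers_injective a haQ
  let e' := e.restrictScalars A
  obtain ⟨w, ⟨_, m, rfl⟩, hw⟩ :=
    Module.FinitePresentation.exists_lift_of_isLocalizedModule S mQ (e'.toLinearMap ∘ₗ mP)
  obtain ⟨u, ⟨_, n, rfl⟩, hu⟩ :=
    Module.FinitePresentation.exists_lift_of_isLocalizedModule S mP (e'.symm.toLinearMap ∘ₗ mQ)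
  have hw' (p : P) : mQ (w p) = a ^ m • e' (mP p) := LinearMap.congr_fun hw p
  have hu' (q : Q) : mP (u q) = a ^ n • e'.symm (mQ q) := LinearMap.congr_fun hu q
  refine ⟨m + n, u, w, fun p ↦ hP ?_, fun q ↦ hQ ?_⟩
  · rw [hu', hw', map_smul, e'.symm_apply_apply, smul_smul, map_smul, pow_add, mul_comm]
  · rw [hw', hu', map_smul, e'.apply_symm_apply, smul_smul, map_smul, pow_add]

end Localization

section Laurent

variable {R : Type*} [CommRing R] (A : Subalgebra R (LaurentPolynomial R))
  (hA : ∀ p : R[X], p.toLaurent ∈ A)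

lemma aeval_toLaurent_X (p : R[X]) :
    aeval (⟨(X : R[X]).toLaurent, hA X⟩ : A) p = ⟨p.toLaurent, hA p⟩ := by
  apply Subtype.ext
  rw [aeval_subalgebra_coe]
  exact (aeval_algHom_apply toLaurentAlg X p).trans (by simp)

lemma isLaurentVariable_toLaurent_X :
    IsLaurentVariable R (⟨(X : R[X]).toLaurent, hA X⟩ : A) where
  aeval_injective p q h := by
    rw [aeval_toLaurent_X, aeval_toLaurent_X] at h
    exact toLaurent_injective (congr_arg Subtype.val h)
  mul_left_injective a ha := by
    have h : (X : R[X]).toLaurent * (a : LaurentPolynomial R) = 0 := congr_arg Subtype.val ha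
    rw [toLaurent_X] at h
    exact Subtype.ext ((LaurentPolynomial.isUnit_T 1).mul_right_eq_zero.mp h)
  exists_pow_mul a := by
    obtain ⟨n, q, hq⟩ := LaurentPolynomial.exists_T_pow (a : LaurentPolynomial R)
    refine ⟨n, q, Subtype.ext ?_⟩
    rw [aeval_toLaurent_X]
    change (X : R[X]).toLaurent ^ n * (a : LaurentPolynomial R) = q.toLaurent
    rw [hq, toLaurent_X, LaurentPolynomial.T_pow, mul_one, mul_comm]

end Laurent

section RankOne

variable {A L : Type*} [CommRing A] [AddCommGroup L] [Module A L] [Module.Finite A L]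
  [Module.Projective A L]

variable (A L) in
lemma rankAtStalk_dual : Module.rankAtStalk (R := A) (Module.Dual A L) =
    Module.rankAtStalk (R := A) L := by
  ext p
  let S := p.asIdeal.primeCompl
  have : Module.FinitePresentation A L := Module.finitePresentation_of_projective A L
  have : Module.Free (Localization.AtPrime p.asIdeal) (LocalizedModule S L) :=
    Module.free_of_flat_of_isLocalRing
  have : Module.Free (Localization.AtPrime p.asIdeal) (LocalizedModule S A) :=
    Module.free_of_flat_of_isLocalRing
  have : Nontrivial A := p.nontrivial
  have h1 : Module.finrank (Localization.AtPrime p.asIdeal) (LocalizedModule S A) = 1 :=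
    congr_fun (Module.rankAtStalk_self (R := A)) p
  have e := (Module.FinitePresentation.linearEquivMapExtendScalars S
    (M := L) (N := A)).extendScalarsOfIsLocalization S (Localization S)
  have h : Module.finrank (Localization.AtPrime p.asIdeal) (LocalizedModule S (Module.Dual A L)) =
      Module.finrank (Localization.AtPrime p.asIdeal)
        (LocalizedModule S L →ₗ[Localization.AtPrime p.asIdeal] LocalizedModule S A) :=
    e.finrank_eq
  rw [Module.finrank_linearMap, h1, mul_one] at h
  exact h

lemma surjective_contractLeft_of_rankAtStalk_pos
    (h : ∀ p, 0 < Module.rankAtStalk (R := A) L p) :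
    Function.Surjective (contractLeft A L) := by
  rw [← LinearMap.range_eq_top]
  by_contra hne
  obtain ⟨m, hm, hle⟩ := Ideal.exists_le_maximal (LinearMap.range (contractLeft A L)) hne
  have hmL : (⊤ : Submodule A L) ≤ m • ⊤ := by
    obtain ⟨s, hs⟩ := Module.projective_def'.mp (inferInstance : Module.Projective A L)
    intro l _
    rw [← LinearMap.id_apply (R := A) l, ← hs, LinearMap.comp_apply,
      Finsupp.linearCombination_apply]
    refine sum_mem fun i _ ↦ Submodule.smul_mem_smul (hle ?_) trivial
    exact ⟨(Finsupp.lapply i ∘ₗ s) ⊗ₜ l, by simp⟩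
  obtain ⟨r, hr, hr0⟩ := Submodule.exists_sub_one_mem_and_smul_eq_zero_of_fg_of_le_smul m ⊤
    Module.Finite.fg_top hmL
  have hmem := (Module.rankAtStalk_pos_iff_mem_support ⟨m, hm.isPrime⟩).mp (h _)
  refine Module.notMem_support_iff'.mpr (fun l ↦ ⟨r, fun hrm ↦ ?_, hr0 l trivial⟩) hmem
  exact hm.ne_top ((Ideal.eq_top_iff_one m).mpr (by simpa using sub_mem hrm hr))

/-- A finite projective module of constant rank one is invertible. -/
lemma invertible_of_hasConstRank_one (h : HasConstRank A L 1) : Module.Invertible A L where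
  bijective := by
    have h1 (p) : Module.rankAtStalk (R := A) L p = 1 := h p.asIdeal
    refine Module.bijective_of_surjective_of_rankAtStalk_eq (M := Module.Dual A L ⊗[A] L)
      (surjective_contractLeft_of_rankAtStalk_pos fun p ↦ (h1 p).symm ▸ one_pos) fun m hm ↦ ?_
    have : Nontrivial A := (⟨m, hm.isPrime⟩ : PrimeSpectrum A).nontrivial
    rw [Module.rankAtStalk_tensorProduct, Module.rankAtStalk_self]
    simp [rankAtStalk_dual, h1]

end RankOne

section Twist

variable {R A : Type*} [CommRing R] [IsLocalRing R] [CommRing A] [Algebra R A]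
  {x : A} (hx : IsLaurentVariable R x) {f : R[X]} (hf : IsSpecialMonic f)

include hx hf

lemma IsLaurentVariable.nonempty_equiv_of_free_summand
    {P Q : Type*} [AddCommGroup P] [Module A P] [Module.Finite A P] [Module.Projective A P]
    [AddCommGroup Q] [Module A Q] [Module.Finite A Q] [Module.Projective A Q]
    (ι : A →ₗ[A] P) (ρ : P →ₗ[A] A) (hρι : ρ ∘ₗ ι = LinearMap.id)
    (u : Q →ₗ[A] P) (w : P →ₗ[A] Q) (huw : ∀ p, u (w p) = aeval x f • p)
    (hwu : ∀ q, w (u q) = aeval x f • q) : Nonempty (P ≃ₗ[A] Q) := by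
  let K := LinearMap.ker ρ
  let e : P ≃ₗ[A] K × A :=
    ((LinearMap.exact_subtype_ker_map ρ).splitSurjectiveEquiv K.injective_subtype ⟨ι, hρι⟩).1
  let := Module.compHom K (algebraMap R A)
  let := Module.compHom Q (algebraMap R A)
  have : IsScalarTower R A K := .of_algebraMap_smul fun _ _ ↦ rfl
  have : IsScalarTower R A Q := .of_algebraMap_smul fun _ _ ↦ rfl
  have : Module.Projective A (K × A) := .of_equiv e
  have : Module.Finite A (K × A) := .equiv e
  have : Module.Finite A K := .of_surjective (LinearMap.fst A K A) LinearMap.fst_surjective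
  have : Module.Projective A K := .of_split (LinearMap.inl A K A) (LinearMap.fst A K A) rfl
  obtain ⟨e'⟩ := hx.nonempty_equiv_prod hf (e.toLinearMap ∘ₗ u) (w ∘ₗ e.symm.toLinearMap)
    (fun p ↦ by simp [huw]) (fun q ↦ by simp [hwu])
  exact ⟨e ≪≫ₗ e'.symm⟩

lemma IsLaurentVariable.nonempty_equiv_of_invertible
    {P Q L : Type*} [AddCommGroup P] [Module A P] [Module.Finite A P] [Module.Projective A P]
    [AddCommGroup Q] [Module A Q] [Module.Finite A Q] [Module.Projective A Q]
    [AddCommGroup L] [Module A L] [Module.Invertible A L]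
    (ι : L →ₗ[A] P) (ρ : P →ₗ[A] L) (hρι : ρ ∘ₗ ι = LinearMap.id)
    (u : Q →ₗ[A] P) (w : P →ₗ[A] Q) (huw : ∀ p, u (w p) = aeval x f • p)
    (hwu : ∀ q, w (u q) = aeval x f • q) : Nonempty (P ≃ₗ[A] Q) := by
  let D := Module.Dual A L
  have eL : D ⊗[A] L ≃ₗ[A] A := Module.Invertible.linearEquiv A L
  have huw' : u ∘ₗ w = aeval x f • LinearMap.id := LinearMap.ext huw
  have hwu' : w ∘ₗ u = aeval x f • LinearMap.id := LinearMap.ext hwu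
  obtain ⟨e⟩ := hx.nonempty_equiv_of_free_summand hf (P := D ⊗[A] P) (Q := D ⊗[A] Q)
    (ι.lTensor D ∘ₗ eL.symm.toLinearMap) (eL.toLinearMap ∘ₗ ρ.lTensor D)
    (LinearMap.ext fun a ↦ by simp [← LinearMap.lTensor_comp_apply, hρι])
    (u.lTensor D) (w.lTensor D)
    (fun y ↦ by
      rw [← LinearMap.lTensor_comp_apply, huw', LinearMap.lTensor_smul, LinearMap.lTensor_id]
      rfl)
    (fun y ↦ by
      rw [← LinearMap.lTensor_comp_apply, hwu', LinearMap.lTensor_smul, LinearMap.lTensor_id]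
      rfl)
  have c : L ⊗[A] D ≃ₗ[A] A := TensorProduct.comm A L D ≪≫ₗ eL
  exact ⟨(Module.Invertible.leftCancelEquiv P c).symm ≪≫ₗ e.lTensor L ≪≫ₗ
    Module.Invertible.leftCancelEquiv Q c⟩

end Twist

/-- Let `R` be a commutative Noetherian local ring and `A` a ring with
`R[X] ⊆ A ⊆ R[X,X⁻¹]`.  Let `P`, `Q` be finitely generated projective `A`-modules of
constant rank with `P_f ≅ Q_f` for some special monic `f ∈ R[X]`.  If `P` or `Q` has a
direct summand of rank one, then `P ≅ Q`. -/
theorem iso_of_special_monic_iso_of_rank_one_summand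
    (R : Type) [CommRing R] [IsNoetherianRing R] [IsLocalRing R]
    (A : Subalgebra R (LaurentPolynomial R))
    (hA : ∀ p : R[X], p.toLaurent ∈ A)
    (P Q : Type) [AddCommGroup P] [Module A P] [Module.Finite A P] [Module.Projective A P]
    [AddCommGroup Q] [Module A Q] [Module.Finite A Q] [Module.Projective A Q]
    (p q : ℕ) (hP : HasConstRank A P p) (hQ : HasConstRank A Q q)
    (f : R[X]) (hf : IsSpecialMonic f)
    (hiso : Nonempty (LocalizedModule (Submonoid.powers (⟨f.toLaurent, hA f⟩ : A)) P
        ≃ₗ[Localization (Submonoid.powers (⟨f.toLaurent, hA f⟩ : A))]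
      LocalizedModule (Submonoid.powers (⟨f.toLaurent, hA f⟩ : A)) Q))
    (hsummand : HasRankOneSummand A P ∨ HasRankOneSummand A Q) :
    Nonempty (P ≃ₗ[A] Q) := by
  let x : A := ⟨(X : R[X]).toLaurent, hA X⟩
  have hx : IsLaurentVariable R x := isLaurentVariable_toLaurent_X A hA
  have hfx : (⟨f.toLaurent, hA f⟩ : A) = aeval x f := (aeval_toLaurent_X A hA f).symm
  have hreg : IsRegular (⟨f.toLaurent, hA f⟩ : A) := hfx ▸ hx.isRegular_aeval hf
  have := Module.finitePresentation_of_projective A P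
  have := Module.finitePresentation_of_projective A Q
  obtain ⟨e⟩ := hiso
  obtain ⟨n, u, w, huw, hwu⟩ := exists_comp_eq_pow_smul_of_localizedModule_equiv _
    (Module.Flat.isSMulRegular_of_isRegular hreg) (Module.Flat.isSMulRegular_of_isRegular hreg) e
  rw [hfx, ← map_pow] at huw hwu
  obtain ⟨L, _, _, _, _, hL, ι, ρ, hρι⟩ | ⟨L, _, _, _, _, hL, ι, ρ, hρι⟩ := hsummand
  · have := invertible_of_hasConstRank_one hL
    exact hx.nonempty_equiv_of_invertible (hf.pow n) ι ρ hρι u w huw hwu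
  · have := invertible_of_hasConstRank_one hL
    obtain ⟨e⟩ := hx.nonempty_equiv_of_invertible (hf.pow n) ι ρ hρι w u hwu huw
    exact ⟨e.symm⟩
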